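/- Fix β > 1 and an increasing function b near 0. Suppose ∫_0^{1/2} \bar{Π}(h(t)) dt < ∞ where h(t) = b(φ(t)) and φ is the increasing function with φ(s^{-s^β}) = (s-1)^{-(s-1)^β} and φ(0)=0. Then Σ_n (1 - exp(-(n+1)^{-(n+1)^β} \bar{Π}(b(n^{-n^β})))) < ∞, i.e. the probabilities that a Lévy process with Lévy measure Π has a jump of modulus larger than b(n^{-n^β}) before time (n+1)^{-(n+1)^β} are summable. -/

import Mathlib

open MeasureTheory ProbabilityTheory Filter Set Topology

noncomputable section

/-- The running supremum of `|X_s|` over `s ∈ [0,t]`. -/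
def supNorm {Ω : Type*} (X : ℝ → Ω → ℝ) (t : ℝ) (ω : Ω) : ℝ :=
  ⨆ s : Set.Icc (0:ℝ) t, |X s.1 ω|

/-- A (one-dimensional) Lévy process: càdlàg, starting at 0, with stationary
independent increments. -/
structure IsLevyProcess {Ω : Type*} [MeasurableSpace Ω] (P : Measure Ω)
    (X : ℝ → Ω → ℝ) : Prop where
  isProb : IsProbabilityMeasure P
  meas : ∀ t : ℝ, Measurable (X t)
  init : ∀ᵐ ω ∂P, X 0 ω = 0
  stationary : ∀ s t : ℝ, 0 ≤ s → 0 ≤ t →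
    Measure.map (fun ω => X (s + t) ω - X s ω) P = Measure.map (X t) P
  indep : ∀ s t : ℝ, 0 ≤ s → 0 ≤ t →
    IndepFun (fun ω => X (s + t) ω - X s ω) (X s) P
  cadlag : ∀ᵐ ω ∂P, ∀ t : ℝ, 0 ≤ t →
    Tendsto (fun s => X s ω) (𝓝[>] t) (𝓝 (X t ω))

/-- `ν` is a Lévy measure (with no atom at zero and `∫ 1 ∧ x² dν < ∞`). -/
def IsLevyMeasure (ν : Measure ℝ) : Prop :=
  ν {0} = 0 ∧ ∫⁻ x, ENNReal.ofReal (min 1 (x ^ 2)) ∂ν ≠ ⊤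

/-- The characteristic exponent associated with the triplet `(γ, σ², ν)`
(jumps bounded by 1). -/
def charExponent (γ σ2 : ℝ) (ν : Measure ℝ) (z : ℝ) : ℂ :=
  Complex.I * (γ : ℂ) * (z : ℂ) - (σ2 : ℂ) * (z : ℂ) ^ 2 / 2 +
    ∫ x in Set.Icc (-1:ℝ) 1,
      (Complex.exp (Complex.I * (z : ℂ) * (x : ℂ)) - 1 - Complex.I * (z : ℂ) * (x : ℂ)) ∂ν

/-- `X` has characteristic triplet `(γ, σ², ν)` under `P`. -/
def HasTriplet {Ω : Type*} [MeasurableSpace Ω] (P : Measure Ω) (X : ℝ → Ω → ℝ)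
    (γ σ2 : ℝ) (ν : Measure ℝ) : Prop :=
  ∀ t : ℝ, 0 ≤ t → ∀ z : ℝ,
    ∫ ω, Complex.exp (Complex.I * (z : ℂ) * (X t ω : ℂ)) ∂P =
      Complex.exp ((t : ℂ) * charExponent γ σ2 ν z)

/-- Generalized (right-continuous) inverse of a function decreasing to `∞` at `0`. -/
def Finv (F : ℝ → ℝ) (y : ℝ) : ℝ := sSup {ε : ℝ | 0 < ε ∧ y ≤ F ε}

/-- The norming function `b_λ(t) = F⁻¹(log|log t|/(λ t))`. -/
def bFun (F : ℝ → ℝ) (lam t : ℝ) : ℝ :=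
  Finv F (Real.log |Real.log t| / (lam * t))

/-- Truncated variance `U(ε) = ε² ν̄(ε) + σ² + ∫_{-ε}^{ε} x² ν(dx)`. -/
def truncVar (σ2 : ℝ) (ν : Measure ℝ) (ε : ℝ) : ℝ :=
  ε ^ 2 * (ν {x : ℝ | ε < |x|}).toReal + σ2 + ∫ x in Set.Icc (-ε) ε, x ^ 2 ∂ν


lemma aux_half (β : ℝ) (hβ : 1 < β) (s : ℝ) (hs : 1 ≤ s) :
    (s + 1) ^ (-((s + 1) ^ β)) ≤ s ^ (-(s ^ β)) / 2 := by
  have h1 : s ^ β + 1 ≤ (s + 1) ^ β := by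
    have := Real.add_rpow_le_rpow_add (a := s) (b := 1) (by linarith) zero_le_one hβ.le
    simpa using this
  have hpos : 0 < s + 1 := by linarith
  have h2 : (s + 1) ^ (-((s + 1) ^ β)) ≤ (s + 1) ^ (-(s ^ β) + (-1)) :=
    Real.rpow_le_rpow_of_exponent_le (by linarith) (by linarith)
  have h3 : (s + 1) ^ (-(s ^ β)) ≤ s ^ (-(s ^ β)) :=
    Real.rpow_le_rpow_of_nonpos (by linarith) (by linarith)
      (neg_nonpos.2 (Real.rpow_nonneg (by linarith) _))
  rw [Real.rpow_add hpos, Real.rpow_neg_one] at h2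
  have h4 : (s + 1)⁻¹ ≤ 2⁻¹ := inv_anti₀ (by norm_num) (by linarith)
  calc _ ≤ _ := h2
    _ ≤ s ^ (-(s ^ β)) * 2⁻¹ := by
      apply mul_le_mul h3 h4 (by positivity)
      exact Real.rpow_nonneg (by linarith) _
    _ = _ := by ring

/-- **Step 2 of the proof of Theorem 1.** If
`∫_0^{1/2} ν̄(h(t)) dt < ∞` where `h = b ∘ φ` and `φ` is increasing with
`φ(s^{-s^β}) = (s-1)^{-(s-1)^β}`, `φ(0) = 0`, then the probabilities
`1 - exp(-(n+1)^{-(n+1)^β} ν̄(b(n^{-n^β})))` of a jump of modulus larger than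
`b(n^{-n^β})` before time `(n+1)^{-(n+1)^β}` are summable. -/
theorem jump_probabilities_summable
    (ν : Measure ℝ) (hν : IsLevyMeasure ν)
    (htail : ∀ r : ℝ, 0 < r → ν {x : ℝ | r < |x|} ≠ ⊤)
    (β : ℝ) (hβ : 1 < β)
    (b φ : ℝ → ℝ) (δ : ℝ) (hδ : 0 < δ)
    (hb : MonotoneOn b (Set.Icc 0 δ)) (hbpos : ∀ t ∈ Set.Ioc (0:ℝ) δ, 0 < b t)
    (hφmono : MonotoneOn φ (Set.Icc (0:ℝ) (1/2))) (hφ0 : φ 0 = 0)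
    (hφmap : ∀ s : ℝ, 2 ≤ s → φ (s ^ (-(s ^ β))) = (s - 1) ^ (-((s - 1) ^ β)))
    (hφrange : ∀ t ∈ Set.Icc (0:ℝ) (1/2), φ t ∈ Set.Icc 0 δ)
    (hint : ∫⁻ t in Set.Ioo (0:ℝ) (1/2), ν {x : ℝ | b (φ t) < |x|} < ⊤) :
    Summable (fun n : ℕ =>
      1 - Real.exp (-(((n : ℝ) + 1) ^ (-(((n : ℝ) + 1) ^ β)) *
        (ν {x : ℝ | b ((n : ℝ) ^ (-((n : ℝ) ^ β))) < |x|}).toReal))) := by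
  set a : ℕ → ℝ := fun n => ((n : ℝ) + 1) ^ (-(((n : ℝ) + 1) ^ β)) with ha
  have hapos : ∀ n, 0 < a n := fun n => Real.rpow_pos_of_pos (by positivity) _
  have hhalf : ∀ n, a (n + 1) ≤ a n / 2 := by
    intro n
    have := aux_half β hβ ((n : ℝ) + 1) (by linarith [n.cast_nonneg (α := ℝ)])
    simpa [ha] using this
  have hanti : Antitone a := antitone_nat_of_succ_le fun n => by
    linarith [hhalf n, hapos n]
  have ha0 : a 0 = 1 := by simp [ha]
  have ha1 : ∀ n, a (n + 1) ≤ 1 / 2 := fun n => by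
    have := hanti (Nat.zero_le n)
    linarith [hhalf n]
  have hφa : ∀ n, φ (a (n + 1)) = a n := by
    intro n
    have := hφmap ((n : ℝ) + 2) (by linarith [n.cast_nonneg (α := ℝ)])
    have e1 : (n : ℝ) + 2 - 1 = n + 1 := by ring
    have e2 : ((n + 1 : ℕ) : ℝ) + 1 = n + 2 := by push_cast; ring
    rw [e1] at this
    simp only [ha, e2]
    exact this
  set T : ℝ → ENNReal := fun r => ν {x : ℝ | r < |x|} with hT
  have hTanti : Antitone T := fun r r' h => measure_mono fun x hx => lt_of_le_of_lt h hx
  -- lower bound of the integrand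
  have hlow : ∀ n, ∀ t ∈ Set.Ioc (a (n + 2)) (a (n + 1)), T (b (a n)) ≤ T (b (φ t)) := by
    intro n t ht
    have htm : t ∈ Set.Icc (0 : ℝ) (1 / 2) :=
      ⟨(hapos _).le.trans ht.1.le, ht.2.trans (ha1 n)⟩
    have ham : a (n + 1) ∈ Set.Icc (0 : ℝ) (1 / 2) := ⟨(hapos _).le, ha1 n⟩
    apply hTanti
    rw [← hφa n]
    exact hb (hφrange _ htm) (hφrange _ ham) (hφmono htm ham ht.2)
  have hpiece : ∀ n, ENNReal.ofReal (a (n + 1) / 2) * T (b (a n)) ≤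
      ∫⁻ t in Set.Ioc (a (n + 2)) (a (n + 1)), T (b (φ t)) := by
    intro n
    calc _ ≤ T (b (a n)) * volume (Set.Ioc (a (n + 2)) (a (n + 1))) := by
          rw [mul_comm, Real.volume_Ioc]
          gcongr
          linarith [hhalf (n + 1)]
      _ = ∫⁻ t in Set.Ioc (a (n + 2)) (a (n + 1)), T (b (a n)) := by
          rw [setLIntegral_const]
      _ ≤ _ := setLIntegral_mono' measurableSet_Ioc (hlow n)
  have hsum : ∑' n : ℕ, ENNReal.ofReal (a (n + 1) / 2) * T (b (a n)) ≠ ⊤ := by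
    refine ne_top_of_le_ne_top ?_ (ENNReal.tsum_le_tsum hpiece)
    have hanti' : Antitone fun n => a (n + 1) := fun m n h => hanti (by omega)
    have hdisj := hanti'.pairwise_disjoint_on_Ioc_succ
    have := lintegral_iUnion (μ := volume) (fun n => measurableSet_Ioc) hdisj
      (fun t => T (b (φ t)))
    simp only [Order.succ_eq_add_one, add_assoc, Nat.reduceAdd] at this
    rw [← this]
    refine ne_top_of_le_ne_top hint.ne ?_
    rw [restrict_Ioo_eq_restrict_Ioc]
    apply lintegral_mono_set
    apply Set.iUnion_subset
    intro n t ht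
    exact ⟨(hapos _).trans ht.1, ht.2.trans (ha1 n)⟩
  have hs := (ENNReal.summable_toReal hsum).mul_left 2
  rw [← summable_nat_add_iff 1]
  refine Summable.of_nonneg_of_le (fun n => ?_) (fun n => ?_) hs
  · rw [sub_nonneg, Real.exp_le_one_iff, neg_nonpos]
    positivity
  · rw [ENNReal.toReal_mul, ENNReal.toReal_ofReal (by linarith [hapos (n + 1)])]
    have e : ((n + 1 : ℕ) : ℝ) = (n : ℝ) + 1 := by push_cast; ring
    have h := Real.add_one_le_exp (-(a (n + 1) * (T (b (a n))).toReal))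
    simp only [ha, hT, e] at h ⊢
    linarith

end
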